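/- Let A be the weighted adjacency matrix of an undirected weighted graph without loops whose row sums are all positive, D the diagonal matrix of row sums, and T = D^{-1} A the transition matrix of the random walk on the graph. Let S₁, …, S_p be pairwise disjoint subsets of vertices, with |S_t| = m_t ≥ 2, such that each S_t carries an (m_t,k_t,s_t)-star with central weight a_t and weight w_t, and suppose the ratio a_t / w_t = ρ is the same for all t. Then −ρ is an eigenvalue of T and the eigenspace ker(T + ρ·I) has dimension at least Σ_{t=1}^{p} (m_t − 1). -/

import Mathlib

/-- If all entries of `A` between distinct vertices of `S` equal `a`, all vertices of `S` have the
same connections outside `S` and the same row sum `w`, then the difference of the indicator vectors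
of two vertices of `S` is an eigenvector of the transition matrix for the eigenvalue `-(a / w)`. -/
theorem single_sub_single_mem_eigenspace {V : Type*} [Fintype V] [DecidableEq V]
    (A : Matrix V V ℝ) (hsymm : A.IsSymm) (hdiag : ∀ i, A i i = 0) (S : Finset V) (a w : ℝ)
    (hcenter : ∀ i ∈ S, ∀ j ∈ S, i ≠ j → A i j = a)
    (hout : ∀ i ∈ S, ∀ j ∈ S, ∀ l, l ∉ S → A i l = A j l)
    (hw : ∀ i ∈ S, ∑ l, A i l = w) {i j : V} (hi : i ∈ S) (hj : j ∈ S) (hij : i ≠ j) :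
    (Pi.single i 1 - Pi.single j 1 : V → ℝ) ∈ Module.End.eigenspace
      (Matrix.toLin' (Matrix.diagonal (fun i => (∑ j, A i j)⁻¹) * A)) (-(a / w)) := by
  rw [Module.End.mem_eigenspace_iff]
  ext l
  simp only [Matrix.toLin'_apply, Matrix.mulVec_sub, Matrix.mulVec_single_one, Pi.sub_apply,
    Matrix.col_apply, Matrix.diagonal_mul, Pi.smul_apply, smul_eq_mul]
  by_cases hl : l ∈ S
  · rw [hw l hl]
    by_cases hli : l = i
    · subst hli
      simp [hdiag, hcenter l hl j hj hij, hij]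
      ring
    · by_cases hlj : l = j
      · subst hlj
        simp [hdiag, hcenter l hl i hi hli, hli]
        ring
      · simp [hcenter l hl i hi hli, hcenter l hl j hj hlj, hli, hlj]
  · have hli : l ≠ i := fun h => hl (h ▸ hi)
    have hlj : l ≠ j := fun h => hl (h ▸ hj)
    simp [← hsymm.apply l, hout i hi j hj l hl, hli, hlj]

/-- For pairwise disjoint sets `S t` with base points `r t ∈ S t`, the differences between the
indicator vectors of the other points of `S t` and of `r t` are linearly independent. -/
theorem linearIndependent_single_sub_single {ι V : Type*} [Fintype ι] [DecidableEq V]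
    (S : ι → Finset V) (hdisj : ∀ t t', t ≠ t' → Disjoint (S t) (S t'))
    (r : ι → V) (hr : ∀ t, r t ∈ S t) :
    LinearIndependent ℝ (fun x : Σ t, {i // i ∈ (S t).erase (r t)} =>
      (Pi.single x.2.1 1 - Pi.single (r x.1) 1 : V → ℝ)) := by
  classical
  have heq : ∀ {t t' : ι} {i : V}, i ∈ S t → i ∈ S t' → t = t' := fun {t t' i} h h' =>
    by_contra fun hne => Finset.disjoint_left.mp (hdisj t t' hne) h h'
  rw [Fintype.linearIndependent_iff]
  rintro g hg ⟨t, i, hi⟩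
  obtain ⟨hir, hiS⟩ := Finset.mem_erase.mp hi
  have h := congrFun hg i
  rw [Finset.sum_apply, Finset.sum_eq_single ⟨t, i, hi⟩] at h
  · simpa [hir] using h
  · rintro ⟨t', j, hj⟩ - hne
    have hij : i ≠ j := by
      rintro rfl
      obtain rfl := heq hiS (Finset.mem_of_mem_erase hj)
      exact hne rfl
    have hir' : i ≠ r t' := by
      rintro rfl
      obtain rfl := heq hiS (hr t')
      exact hir rfl
    simp [hij, hir']
  · simp


/-- In a loopless weighted graph with all row sums positive, if pairwise
disjoint subsets `S t` (of sizes `m t ≥ 2`) carry `(m_t,k_t,s_t)`-stars with central weights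
`a t` and weights `w t` such that the ratio `a t / w t = ρ` is the same for all `t`, then
`-ρ` is an eigenvalue of the transition matrix `T = D⁻¹ A` with eigenspace of dimension at
least `∑ (m t - 1)`. -/
theorem stmt_6 {n p : ℕ} (hp : 0 < p) (A : Matrix (Fin n) (Fin n) ℝ)
    (hsymm : A.IsSymm)
    (hnonneg : ∀ i j, 0 ≤ A i j)
    (hdiag : ∀ i, A i i = 0)
    (hpos : ∀ i, 0 < ∑ j, A i j)
    (T : Matrix (Fin n) (Fin n) ℝ)
    (hT : T = Matrix.diagonal (fun i => (∑ j, A i j)⁻¹) * A)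
    (S : Fin p → Finset (Fin n)) (m : Fin p → ℕ)
    (hm : ∀ t, 2 ≤ m t) (hcard : ∀ t, (S t).card = m t)
    (hdisj : ∀ t t', t ≠ t' → Disjoint (S t) (S t'))
    (a w : Fin p → ℝ) (ha : ∀ t, 0 ≤ a t)
    (hstar_center : ∀ t, ∀ i ∈ S t, ∀ j ∈ S t, i ≠ j → A i j = a t)
    (hstar_out : ∀ t, ∀ i ∈ S t, ∀ j ∈ S t, ∀ l, l ∉ S t → A i l = A j l)
    (hw : ∀ t, ∀ i ∈ S t, ∑ l, A i l = w t)
    (ρ : ℝ) (hρ : ∀ t, a t / w t = ρ) :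
    Module.End.HasEigenvalue (Matrix.toLin' T) (-ρ) ∧
    (∑ t, (m t - 1)) ≤
      Module.finrank ℝ (Module.End.eigenspace (Matrix.toLin' T) (-ρ)) := by
  subst hT
  have hne : ∀ t, (S t).Nonempty := fun t => by
    rw [← Finset.card_pos, hcard t]
    exact zero_lt_two.trans_le (hm t)
  choose r hr using hne
  set E := Module.End.eigenspace
    (Matrix.toLin' (Matrix.diagonal (fun i => (∑ j, A i j)⁻¹) * A)) (-ρ) with hE
  have hmem : ∀ x : Σ t, {i // i ∈ (S t).erase (r t)},
      (Pi.single x.2.1 1 - Pi.single (r x.1) 1 : Fin n → ℝ) ∈ E := by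
    rintro ⟨t, i, hi⟩
    obtain ⟨hir, hiS⟩ := Finset.mem_erase.mp hi
    rw [hE, ← hρ t]
    exact single_sub_single_mem_eigenspace A hsymm hdiag (S t) (a t) (w t) (hstar_center t)
      (hstar_out t) (hw t) hiS (hr t) hir
  have hli : LinearIndependent ℝ (fun x => (⟨_, hmem x⟩ : E)) :=
    LinearIndependent.of_comp E.subtype (linearIndependent_single_sub_single S hdisj r hr)
  have hdim : ∑ t, (m t - 1) ≤ Module.finrank ℝ E := by
    simpa only [Fintype.card_sigma, Fintype.card_coe, Finset.card_erase_of_mem (hr _), hcard]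
      using hli.fintype_card_le_finrank
  refine ⟨fun hbot => ?_, hdim⟩
  have hzero : Module.finrank ℝ E = 0 := Submodule.finrank_eq_zero.mpr hbot
  have hle : m ⟨0, hp⟩ - 1 ≤ ∑ t, (m t - 1) :=
    Finset.single_le_sum (f := fun t => m t - 1) (fun _ _ => Nat.zero_le _) (Finset.mem_univ _)
  have := hm ⟨0, hp⟩
  omega
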